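/- Let N ≥ 2 and let (O, c) be an N-qubit doily root: O = {o_1,...,o_5} is a set of five mutually anticommuting N-qubit Pauli observables whose product is ± the identity, and c is an N-qubit Pauli observable commuting with o_1, o_2, o_3 and anticommuting with o_4, o_5. Then there is exactly one N-qubit doily containing O and c among its points. -/

import Mathlib

open scoped Matrix

/-- The four Pauli matrices `I, X, Y, Z`. -/
noncomputable def pauliMat : Fin 4 → Matrix (Fin 2) (Fin 2) ℂ
  | 0 => 1
  | 1 => !![0, 1; 1, 0]
  | 2 => !![0, -Complex.I; Complex.I, 0]
  | 3 => !![1, 0; 0, -1]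

/-- The `2^N × 2^N` matrix of the `N`-qubit Pauli word `w`, i.e. the tensor product
`G_1 ⊗ ⋯ ⊗ G_N` where `G_k = pauliMat (w k)`. -/
noncomputable def obsMat {N : ℕ} (w : Fin N → Fin 4) :
    Matrix (Fin N → Fin 2) (Fin N → Fin 2) ℂ :=
  Matrix.of fun i j => ∏ k, pauliMat (w k) (i k) (j k)

/-- Two Pauli words commute (as matrices). -/
def PCommute {N : ℕ} (a b : Fin N → Fin 4) : Prop :=
  obsMat a * obsMat b = obsMat b * obsMat a

/-- Two Pauli words anticommute (as matrices). -/
def PAnticommute {N : ℕ} (a b : Fin N → Fin 4) : Prop :=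
  obsMat a * obsMat b = -(obsMat b * obsMat a)

/-- A point of the doily, in Sylvester's duad model: a 2-element subset of a 6-element set. -/
def Duad : Type := {s : Finset (Fin 6) // s.card = 2}

instance : Fintype Duad := Subtype.fintype _

instance : DecidableEq Duad := Subtype.instDecidableEq

/-- A line of the doily: a syntheme, i.e. a set of three pairwise disjoint duads. -/
def Syntheme : Type :=
  {t : Finset Duad // t.card = 3 ∧ ∀ p ∈ t, ∀ q ∈ t, p ≠ q → p.1 ∩ q.1 = ∅}

/-- `f` labels the points of the doily by `N`-qubit Pauli observables so as to form an
`N`-qubit doily: the labels are distinct nonidentity observables, two points are collinear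
iff their observables commute, and the product of the three observables on any line is
`±` the identity. -/
def IsNQubitDoily (N : ℕ) (f : Duad → (Fin N → Fin 4)) : Prop :=
  Function.Injective f ∧
  (∀ p, f p ≠ fun _ => 0) ∧
  (∀ p q : Duad, p ≠ q →
    ((∃ L : Syntheme, p ∈ L.1 ∧ q ∈ L.1) ↔ PCommute (f p) (f q))) ∧
  (∀ L : Syntheme, ∀ p ∈ L.1, ∀ q ∈ L.1, ∀ r ∈ L.1, p ≠ q → p ≠ r → q ≠ r →
    obsMat (f p) * obsMat (f q) * obsMat (f r) = 1 ∨
    obsMat (f p) * obsMat (f q) * obsMat (f r) = -1)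

/-- `D` is the point set of some `N`-qubit doily. -/
def IsDoilySet (N : ℕ) (D : Finset (Fin N → Fin 4)) : Prop :=
  ∃ f : Duad → (Fin N → Fin 4),
    IsNQubitDoily N f ∧ D = Finset.image f Finset.univ

/-- The symplectic encoding `I ↦ (0,0)`, `X ↦ (1,0)`, `Y ↦ (1,1)`, `Z ↦ (0,1)`. -/
def pauliBits : Fin 4 ≃ ZMod 2 × ZMod 2 where
  toFun := ![(0, 0), (1, 0), (1, 1), (0, 1)]
  invFun x := if x.1 = 0 then (if x.2 = 0 then 0 else 3) else (if x.2 = 0 then 1 else 2)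
  left_inv := by decide
  right_inv := by decide

/-- The symplectic encoding of Pauli words. -/
def wordBits (N : ℕ) : (Fin N → Fin 4) ≃ (Fin N → ZMod 2 × ZMod 2) :=
  Equiv.arrowCongr (Equiv.refl _) pauliBits

/-- The symplectic form on encoded Pauli words. -/
def sympForm (N : ℕ) : LinearMap.BilinForm (ZMod 2) (Fin N → ZMod 2 × ZMod 2) :=
  LinearMap.mk₂ (ZMod 2) (fun x y => ∑ k, ((x k).1 * (y k).2 + (x k).2 * (y k).1))
    (fun x x' y => by
      simp only [Pi.add_apply, Prod.fst_add, Prod.snd_add, ← Finset.sum_add_distrib]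
      exact Finset.sum_congr rfl fun k _ => by ring)
    (fun a x y => by
      simp only [Pi.smul_apply, Prod.smul_fst, Prod.smul_snd, smul_eq_mul, Finset.mul_sum]
      exact Finset.sum_congr rfl fun k _ => by ring)
    (fun x y y' => by
      simp only [Pi.add_apply, Prod.fst_add, Prod.snd_add, ← Finset.sum_add_distrib]
      exact Finset.sum_congr rfl fun k _ => by ring)
    (fun a x y => by
      simp only [Pi.smul_apply, Prod.smul_fst, Prod.smul_snd, smul_eq_mul, Finset.mul_sum]
      exact Finset.sum_congr rfl fun k _ => by ring)

lemma sympForm_apply {N : ℕ} (x y : Fin N → ZMod 2 × ZMod 2) :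
    sympForm N x y = ∑ k, ((x k).1 * (y k).2 + (x k).2 * (y k).1) := rfl

lemma sympForm_comm {N : ℕ} (x y : Fin N → ZMod 2 × ZMod 2) :
    sympForm N x y = sympForm N y x := by
  simp only [sympForm_apply]
  exact Finset.sum_congr rfl fun k _ => by ring

lemma sympForm_self {N : ℕ} (x : Fin N → ZMod 2 × ZMod 2) : sympForm N x x = 0 := by
  rw [sympForm_apply]
  exact Finset.sum_eq_zero fun k _ => by rw [mul_comm, CharTwo.add_self_eq_zero]

/-- The sign `(-1) ^ x`. -/
noncomputable def bitSign (x : ZMod 2) : ℂ := if x = 0 then 1 else -1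

lemma bitSign_add (x y : ZMod 2) : bitSign (x + y) = bitSign x * bitSign y := by
  have h : ∀ x y : ZMod 2, x + y = 0 ↔ (x = 0 ↔ y = 0) := by decide
  simp only [bitSign, h]
  split_ifs <;> simp_all

lemma bitSign_sum {ι : Type*} (s : Finset ι) (f : ι → ZMod 2) :
    bitSign (∑ i ∈ s, f i) = ∏ i ∈ s, bitSign (f i) := by
  classical
  induction s using Finset.induction_on with
  | empty => simp [bitSign]
  | insert i s hi ih => rw [Finset.sum_insert hi, Finset.prod_insert hi, bitSign_add, ih]

lemma pauliMat_mul (a b : Fin 4) : ∃ z : ℂ, z ≠ 0 ∧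
    pauliMat a * pauliMat b = z • pauliMat (pauliBits.symm (pauliBits a + pauliBits b)) := by
  refine ⟨!![1, 1, 1, 1; 1, 1, Complex.I, -Complex.I; 1, -Complex.I, 1, Complex.I;
    1, Complex.I, -Complex.I, 1] a b, ?_, ?_⟩
  · fin_cases a <;> fin_cases b <;> simp
  · fin_cases a <;> fin_cases b <;>
      simp [pauliMat, pauliBits, Matrix.one_fin_two, CharTwo.add_self_eq_zero]

lemma pauliMat_mul_comm (a b : Fin 4) : pauliMat a * pauliMat b =
    bitSign ((pauliBits a).1 * (pauliBits b).2 + (pauliBits a).2 * (pauliBits b).1) •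
      (pauliMat b * pauliMat a) := by
  fin_cases a <;> fin_cases b <;> simp [pauliMat, pauliBits, bitSign, CharTwo.add_self_eq_zero]

lemma pauliMat_mul_self (a : Fin 4) : pauliMat a * pauliMat a = 1 := by
  fin_cases a <;> simp [pauliMat, Matrix.one_fin_two]

lemma trace_pauliMat {a : Fin 4} (ha : a ≠ 0) : (pauliMat a).trace = 0 := by
  fin_cases a <;> simp_all [pauliMat, Matrix.trace_fin_two]

lemma obsMat_mul_apply {N : ℕ} (a b : Fin N → Fin 4) (i j : Fin N → Fin 2) :
    (obsMat a * obsMat b) i j = ∏ k, (pauliMat (a k) * pauliMat (b k)) (i k) (j k) := by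
  simp only [Matrix.mul_apply, obsMat, Matrix.of_apply, ← Finset.prod_mul_distrib,
    Finset.prod_univ_sum, Fintype.piFinset_univ]

lemma obsMat_zero {N : ℕ} : obsMat (fun _ : Fin N => 0) = 1 := by
  ext i j
  simp only [obsMat, pauliMat, Matrix.of_apply, Matrix.one_apply, Finset.prod_ite_zero,
    Finset.prod_const_one, Finset.mem_univ, true_imp_iff, funext_iff]

lemma obsMat_mul_self {N : ℕ} (a : Fin N → Fin 4) : obsMat a * obsMat a = 1 := by
  ext i j
  rw [obsMat_mul_apply, ← obsMat_zero]
  simp only [pauliMat_mul_self]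
  rfl

lemma obsMat_mul {N : ℕ} (a b : Fin N → Fin 4) : ∃ z : ℂ, z ≠ 0 ∧
    obsMat a * obsMat b = z • obsMat ((wordBits N).symm (wordBits N a + wordBits N b)) := by
  choose z hz h using pauliMat_mul
  refine ⟨∏ k, z (a k) (b k), Finset.prod_ne_zero_iff.2 fun k _ => hz _ _, ?_⟩
  ext i j
  rw [obsMat_mul_apply]
  simp only [h, Matrix.smul_apply, smul_eq_mul, Finset.prod_mul_distrib]
  rfl

lemma obsMat_mul_comm {N : ℕ} (a b : Fin N → Fin 4) : obsMat a * obsMat b =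
    bitSign (sympForm N (wordBits N a) (wordBits N b)) • (obsMat b * obsMat a) := by
  ext i j
  rw [Matrix.smul_apply, obsMat_mul_apply, obsMat_mul_apply, sympForm_apply, bitSign_sum,
    smul_eq_mul, ← Finset.prod_mul_distrib]
  refine Finset.prod_congr rfl fun k _ => ?_
  rw [pauliMat_mul_comm]
  rfl

lemma trace_obsMat {N : ℕ} (w : Fin N → Fin 4) :
    (obsMat w).trace = ∏ k, (pauliMat (w k)).trace := by
  simp only [Matrix.trace, Matrix.diag, obsMat, Matrix.of_apply, Finset.prod_univ_sum,
    Fintype.piFinset_univ]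

lemma eq_zero_of_obsMat_eq_smul_one {N : ℕ} {w : Fin N → Fin 4} {z : ℂ} (hz : z ≠ 0)
    (h : obsMat w = z • 1) : w = fun _ => 0 := by
  by_contra hw
  obtain ⟨k, hk⟩ := Function.ne_iff.1 hw
  have htr := trace_obsMat w
  rw [Finset.prod_eq_zero (Finset.mem_univ k) (trace_pauliMat hk), h] at htr
  simp [hz] at htr

lemma obsMat_mul_ne_zero {N : ℕ} (a b : Fin N → Fin 4) : obsMat a * obsMat b ≠ 0 := by
  intro h
  have h' : obsMat a * (obsMat a * obsMat b) * obsMat b = 1 := by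
    rw [← mul_assoc, obsMat_mul_self, one_mul, obsMat_mul_self]
  rw [h] at h'
  simp at h'

lemma obsMat_mul_ne_neg {N : ℕ} (a b : Fin N → Fin 4) :
    obsMat a * obsMat b ≠ -(obsMat a * obsMat b) := by
  intro h
  rw [eq_neg_iff_add_eq_zero, ← two_smul ℂ, smul_eq_zero] at h
  exact h.elim two_ne_zero (obsMat_mul_ne_zero a b)

lemma pCommute_iff {N : ℕ} {a b : Fin N → Fin 4} :
    PCommute a b ↔ sympForm N (wordBits N a) (wordBits N b) = 0 := by
  unfold PCommute
  rw [obsMat_mul_comm a b]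
  constructor
  · intro e
    by_contra hs
    rw [bitSign, if_neg hs, neg_smul, one_smul] at e
    exact obsMat_mul_ne_neg b a e.symm
  · intro e
    simp [bitSign, e]

lemma pAnticommute_iff {N : ℕ} {a b : Fin N → Fin 4} :
    PAnticommute a b ↔ sympForm N (wordBits N a) (wordBits N b) = 1 := by
  have h2 : ∀ x : ZMod 2, x = 1 ↔ x ≠ 0 := by decide
  unfold PAnticommute
  rw [obsMat_mul_comm a b, h2]
  constructor
  · intro e hs
    rw [bitSign, if_pos hs, one_smul] at e
    exact obsMat_mul_ne_neg b a e
  · intro e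
    simp [bitSign, e]

lemma wordBits_zero {N : ℕ} : wordBits N (fun _ => 0) = 0 := rfl

lemma obsMat_list_prod {N : ℕ} (l : List (Fin N → Fin 4)) : ∃ z : ℂ, z ≠ 0 ∧
    (l.map obsMat).prod = z • obsMat ((wordBits N).symm (l.map (wordBits N)).sum) := by
  induction l with
  | nil => exact ⟨1, one_ne_zero, by simp [← wordBits_zero, obsMat_zero]⟩
  | cons a l ih =>
    obtain ⟨z, hz, h⟩ := ih
    obtain ⟨y, hy, h'⟩ := obsMat_mul a ((wordBits N).symm (l.map (wordBits N)).sum)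
    refine ⟨z * y, mul_ne_zero hz hy, ?_⟩
    rw [List.map_cons, List.prod_cons, h, Matrix.mul_smul, h', smul_smul]
    simp

lemma sum_wordBits_eq_zero {N : ℕ} {l : List (Fin N → Fin 4)}
    (h : (l.map obsMat).prod = 1 ∨ (l.map obsMat).prod = -1) :
    (l.map (wordBits N)).sum = 0 := by
  obtain ⟨z, hz, hl⟩ := obsMat_list_prod l
  have key : ∃ y : ℂ, y ≠ 0 ∧ (l.map obsMat).prod = y • 1 := by
    rcases h with h | h
    · exact ⟨1, one_ne_zero, by rw [h, one_smul]⟩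
    · exact ⟨-1, by simp, by rw [h, neg_smul, one_smul]⟩
  obtain ⟨y, hy, h⟩ := key
  rw [h] at hl
  have := eq_zero_of_obsMat_eq_smul_one (mul_ne_zero (inv_ne_zero hz) hy)
    (by rw [← smul_smul, hl, inv_smul_smul₀ hz])
  rw [← wordBits_zero, ← this, Equiv.apply_symm_apply]

lemma obsMat_mul_mul_eq_one_or {N : ℕ} {a b c : Fin N → Fin 4}
    (h : wordBits N a + wordBits N b + wordBits N c = 0) (hab : PCommute a b)
    (hac : PCommute a c) (hbc : PCommute b c) :
    obsMat a * obsMat b * obsMat c = 1 ∨ obsMat a * obsMat b * obsMat c = -1 := by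
  obtain ⟨z, -, hl⟩ := obsMat_list_prod [a, b, c]
  simp only [List.map_cons, List.map_nil, List.prod_cons, List.prod_nil, mul_one,
    List.sum_cons, List.sum_nil, add_zero, ← mul_assoc, ← add_assoc, h] at hl
  rw [← wordBits_zero, Equiv.symm_apply_apply, obsMat_zero] at hl
  have hsq : (obsMat a * obsMat b * obsMat c) * (obsMat a * obsMat b * obsMat c) = 1 := by
    have hA : Commute (obsMat a) (obsMat b) := hab
    have hB : Commute (obsMat a) (obsMat c) := hac
    have hC : Commute (obsMat b) (obsMat c) := hbc
    rw [((hB.mul_left hC).symm).mul_mul_mul_comm, hA.symm.mul_mul_mul_comm, obsMat_mul_self,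
      obsMat_mul_self, obsMat_mul_self, one_mul, one_mul]
  rw [hl] at hsq ⊢
  have hz : z * z = 1 := by
    have := congr_fun (congr_fun hsq (fun _ => 0)) (fun _ => 0)
    simpa using this
  rcases mul_self_eq_one_iff.1 hz with rfl | rfl <;> simp

lemma exists_syntheme_iff {p q : Duad} (hpq : p ≠ q) :
    (∃ L : Syntheme, p ∈ L.1 ∧ q ∈ L.1) ↔ p.1 ∩ q.1 = ∅ := by
  constructor
  · rintro ⟨L, hp, hq⟩
    exact L.2.2 p hp q hq hpq
  · intro h
    have hcard : (p.1 ∪ q.1).card = 4 := by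
      rw [Finset.card_union_of_disjoint (Finset.disjoint_iff_inter_eq_empty.2 h), p.2, q.2]
    let r : Duad := ⟨(p.1 ∪ q.1)ᶜ, by rw [Finset.card_compl, hcard]; rfl⟩
    have hpr : p.1 ∩ r.1 = ∅ := by ext; simp [r]; tauto
    have hqr : q.1 ∩ r.1 = ∅ := by ext; simp [r]; tauto
    have hne : ∀ {s t : Duad}, s.1 ∩ t.1 = ∅ → s ≠ t := by
      rintro s _ h rfl
      have := s.2
      rw [Finset.inter_self] at h
      simp [h] at this
    refine ⟨⟨{p, q, r}, Finset.card_eq_three.2 ⟨p, q, r, hpq, hne hpr, hne hqr, rfl⟩, ?_⟩,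
      by simp, by simp⟩
    intro s hs t ht hst
    simp only [Finset.mem_insert, Finset.mem_singleton] at hs ht
    rcases hs with rfl | rfl | rfl <;> rcases ht with rfl | rfl | rfl <;>
      first
        | exact absurd rfl hst
        | assumption
        | (rw [Finset.inter_comm]; assumption)

/-- The Gram matrix of the vectors `n, o₁, …, o₅`, where `n` is orthogonal to the five pairwise
non-orthogonal `oᵢ`. -/
def rootGram (i j : Fin 6) : ZMod 2 := if i = 0 ∨ j = 0 ∨ i = j then 0 else 1

lemma sum_rootGram (p q : Duad) :
    ∑ i ∈ p.1, ∑ j ∈ q.1, rootGram i j = ((p.1 ∩ q.1).card : ZMod 2) := by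
  revert p q
  decide +kernel

lemma inter_card_eq_zero_iff (p q : Duad) (hpq : p ≠ q) :
    ((p.1 ∩ q.1).card : ZMod 2) = 0 ↔ p.1 ∩ q.1 = ∅ := by
  revert p q
  decide +kernel

lemma exists_inter_card_ne (p q : Duad) (hpq : p ≠ q) :
    ∃ r : Duad, ((p.1 ∩ r.1).card : ZMod 2) ≠ ((q.1 ∩ r.1).card : ZMod 2) := by
  revert p q
  decide +kernel

lemma exists_inter_card_ne_zero (p : Duad) :
    ∃ r : Duad, ((p.1 ∩ r.1).card : ZMod 2) ≠ 0 := by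
  revert p
  decide +kernel

lemma union_eq_univ {p q r : Duad} (hpq : p.1 ∩ q.1 = ∅) (hpr : p.1 ∩ r.1 = ∅)
    (hqr : q.1 ∩ r.1 = ∅) : p.1 ∪ q.1 ∪ r.1 = Finset.univ := by
  rw [← Finset.disjoint_iff_inter_eq_empty] at hpq hpr hqr
  rw [← Finset.card_eq_iff_eq_univ, Finset.card_union_of_disjoint
    (Finset.disjoint_union_left.2 ⟨hpr, hqr⟩), Finset.card_union_of_disjoint hpq, p.2, q.2, r.2]
  rfl

/-- A set of duads closed under completing lines is everything as soon as it contains the ovoid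
of duads through `0` and the duad `{4, 5}`. -/
lemma duad_closure {T : Duad → Prop} (h0 : ∀ p : Duad, 0 ∈ p.1 → T p)
    (hc : ∀ p : Duad, p.1 = {4, 5} → T p)
    (hT : ∀ p q r : Duad, p.1 ∩ q.1 = ∅ → p.1 ∩ r.1 = ∅ → q.1 ∩ r.1 = ∅ → T p → T q → T r)
    (r : Duad) : T r := by
  have step : ∀ r : Duad, r.1 ⊆ {1, 2, 3} → T r := by
    intro r hr
    have : ∃ p q : Duad, p.1 = {4, 5} ∧ 0 ∈ q.1 ∧ p.1 ∩ q.1 = ∅ ∧ p.1 ∩ r.1 = ∅ ∧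
        q.1 ∩ r.1 = ∅ := by
      revert r
      decide +kernel
    obtain ⟨p, q, hp, hq, h₁, h₂, h₃⟩ := this
    exact hT p q r h₁ h₂ h₃ (hc p hp) (h0 q hq)
  have : 0 ∈ r.1 ∨ r.1 = {4, 5} ∨ r.1 ⊆ {1, 2, 3} ∨ ∃ p q : Duad, p.1 ⊆ {1, 2, 3} ∧ 0 ∈ q.1 ∧
      p.1 ∩ q.1 = ∅ ∧ p.1 ∩ r.1 = ∅ ∧ q.1 ∩ r.1 = ∅ := by
    revert r
    decide +kernel
  obtain h | h | h | ⟨p, q, hp, hq, h₁, h₂, h₃⟩ := this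
  · exact h0 r h
  · exact hc r h
  · exact step r h
  · exact hT p q r h₁ h₂ h₃ (step p hp) (h0 q hq)

/-- The encoded observable attached to the duad `p` by a family `v = (n, o₁, …, o₅)`. -/
def rootVec {V : Type*} [AddCommMonoid V] (v : Fin 6 → V) (p : Duad) : V :=
  v 0 + ∑ i ∈ p.1, v i

lemma sympForm_rootVec {N : ℕ} {v : Fin 6 → Fin N → ZMod 2 × ZMod 2}
    (hv : ∀ i j, sympForm N (v i) (v j) = rootGram i j) (p q : Duad) :
    sympForm N (rootVec v p) (rootVec v q) = ((p.1 ∩ q.1).card : ZMod 2) := by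
  have h0 : ∀ j, rootGram 0 j = 0 := by decide
  have h0' : ∀ i, rootGram i 0 = 0 := by decide
  simp only [rootVec, map_add, LinearMap.add_apply, map_sum, LinearMap.sum_apply, hv, h0, h0',
    Finset.sum_const_zero, zero_add, ← sum_rootGram]
  exact Finset.sum_comm

lemma rootVec_add_add {N : ℕ} {v : Fin 6 → Fin N → ZMod 2 × ZMod 2} (hs : ∑ i, v i = v 0)
    {p q r : Duad} (hpq : p.1 ∩ q.1 = ∅) (hpr : p.1 ∩ r.1 = ∅) (hqr : q.1 ∩ r.1 = ∅) :
    rootVec v p + rootVec v q + rootVec v r = 0 := by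
  have h := hs
  rw [← union_eq_univ hpq hpr hqr, Finset.sum_union, Finset.sum_union] at h
  · have h2 : v 0 + v 0 = 0 := ZModModule.add_self (v 0)
    calc rootVec v p + rootVec v q + rootVec v r
        = (v 0 + v 0) + (v 0 + (∑ i ∈ p.1, v i + ∑ i ∈ q.1, v i + ∑ i ∈ r.1, v i)) := by
          simp only [rootVec]; abel
      _ = 0 := by rw [h, h2, add_zero]
  · exact Finset.disjoint_iff_inter_eq_empty.2 hpq
  · rw [← Finset.disjoint_iff_inter_eq_empty] at hpr hqr
    exact Finset.disjoint_union_left.2 ⟨hpr, hqr⟩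

lemma rootVec_injective {N : ℕ} {v : Fin 6 → Fin N → ZMod 2 × ZMod 2}
    (hv : ∀ i j, sympForm N (v i) (v j) = rootGram i j) : Function.Injective (rootVec v) := by
  intro p q h
  by_contra hpq
  obtain ⟨r, hr⟩ := exists_inter_card_ne p q hpq
  rw [← sympForm_rootVec hv, ← sympForm_rootVec hv, h] at hr
  exact hr rfl

lemma isNQubitDoily_rootVec {N : ℕ} {v : Fin 6 → Fin N → ZMod 2 × ZMod 2}
    (hv : ∀ i j, sympForm N (v i) (v j) = rootGram i j) (hs : ∑ i, v i = v 0) :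
    IsNQubitDoily N fun p => (wordBits N).symm (rootVec v p) := by
  have hcomm : ∀ p q : Duad, p ≠ q →
      (PCommute ((wordBits N).symm (rootVec v p)) ((wordBits N).symm (rootVec v q)) ↔
        p.1 ∩ q.1 = ∅) := fun p q hpq => by
    rw [pCommute_iff, Equiv.apply_symm_apply, Equiv.apply_symm_apply, sympForm_rootVec hv,
      inter_card_eq_zero_iff p q hpq]
  refine ⟨(wordBits N).symm.injective.comp (rootVec_injective hv), fun p hp => ?_,
    fun p q hpq => by rw [exists_syntheme_iff hpq, hcomm p q hpq], ?_⟩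
  · obtain ⟨r, hr⟩ := exists_inter_card_ne_zero p
    rw [Equiv.symm_apply_eq, wordBits_zero] at hp
    rw [← sympForm_rootVec hv, hp, map_zero] at hr
    exact hr rfl
  · intro L p hp q hq r hr hpq hpr hqr
    have h₁ := L.2.2 p hp q hq hpq
    have h₂ := L.2.2 p hp r hr hpr
    have h₃ := L.2.2 q hq r hr hqr
    refine obsMat_mul_mul_eq_one_or ?_ ((hcomm p q hpq).2 h₁) ((hcomm p r hpr).2 h₂)
      ((hcomm q r hqr).2 h₃)
    simpa only [Equiv.apply_symm_apply] using rootVec_add_add hs h₁ h₂ h₃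

/-- The point set of a doily is closed under multiplying distinct commuting observables. -/
lemma IsDoilySet.add_mem {N : ℕ} {D : Finset (Fin N → Fin 4)} (hD : IsDoilySet N D)
    {a b c : Fin N → Fin 4} (ha : a ∈ D) (hb : b ∈ D) (hab : a ≠ b) (hcomm : PCommute a b)
    (h : wordBits N a + wordBits N b + wordBits N c = 0) : c ∈ D := by
  obtain ⟨f, ⟨-, -, hf, hline⟩, rfl⟩ := hD
  obtain ⟨p, -, rfl⟩ := Finset.mem_image.1 ha
  obtain ⟨q, -, rfl⟩ := Finset.mem_image.1 hb
  have hpq : p ≠ q := fun h => hab (h ▸ rfl)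
  obtain ⟨L, hp, hq⟩ := (hf p q hpq).2 hcomm
  have hlt : ({p, q} : Finset Duad).card < L.1.card := by
    rw [L.2.1, Finset.card_pair hpq]
    decide
  obtain ⟨r, hr, hr'⟩ := Finset.exists_mem_notMem_of_card_lt_card hlt
  simp only [Finset.mem_insert, Finset.mem_singleton, not_or] at hr'
  have hsum := sum_wordBits_eq_zero (l := [f p, f q, f r]) (by
    simpa [mul_assoc] using hline L p hp q hq r hr hpq (Ne.symm hr'.1) (Ne.symm hr'.2))
  simp only [List.map_cons, List.map_nil, List.sum_cons, List.sum_nil, add_zero,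
    ← add_assoc] at hsum
  have hcr : c = f r := (wordBits N).injective (add_left_cancel (h.trans hsum.symm))
  exact hcr ▸ Finset.mem_image_of_mem f (Finset.mem_univ r)

lemma IsDoilySet.card_eq {N : ℕ} {D : Finset (Fin N → Fin 4)} (hD : IsDoilySet N D) :
    D.card = Fintype.card Duad := by
  obtain ⟨f, ⟨hf, -⟩, rfl⟩ := hD
  exact Finset.card_image_of_injective _ hf

/-- The duads through `0` carry the vectors `v i` with `i ≠ 0`. -/
lemma rootVec_of_zero_mem {V : Type*} [AddCommGroup V] [Module (ZMod 2) V] (v : Fin 6 → V)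
    {p : Duad} (hp : 0 ∈ p.1) : ∃ i ≠ 0, rootVec v p = v i := by
  have : ∃ i : Fin 6, i ≠ 0 ∧ p.1 = {0, i} := by
    revert p
    decide +kernel
  obtain ⟨i, hi, hp⟩ := this
  refine ⟨i, hi, ?_⟩
  rw [rootVec, hp, Finset.sum_pair hi.symm, ← add_assoc, ZModModule.add_self,
    zero_add]

/-- The doily attached to `v` is contained in every doily containing its root. -/
lemma image_rootVec_subset {N : ℕ} {v : Fin 6 → Fin N → ZMod 2 × ZMod 2}
    (hv : ∀ i j, sympForm N (v i) (v j) = rootGram i j) (hs : ∑ i, v i = v 0)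
    {D : Finset (Fin N → Fin 4)} (hD : IsDoilySet N D)
    (ho : ∀ i ≠ 0, (wordBits N).symm (v i) ∈ D)
    (hc : (wordBits N).symm (v 0 + (v 4 + v 5)) ∈ D) :
    Finset.univ.image (fun p => (wordBits N).symm (rootVec v p)) ⊆ D := by
  intro w hw
  obtain ⟨p, -, rfl⟩ := Finset.mem_image.1 hw
  refine duad_closure (T := fun p => (wordBits N).symm (rootVec v p) ∈ D) ?_ ?_ ?_ p
  · intro p hp
    obtain ⟨i, hi, h⟩ := rootVec_of_zero_mem v hp
    rw [h]
    exact ho i hi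
  · intro p hp
    rwa [rootVec, hp, Finset.sum_pair (by decide)]
  · intro p q r hpq hpr hqr hp hq
    have hne : p ≠ q := by
      rintro rfl
      have := p.2
      rw [Finset.inter_self] at hpq
      simp [hpq] at this
    refine hD.add_mem hp hq
      (fun h => hne (rootVec_injective hv ((wordBits N).symm.injective h))) ?_ ?_
    · rw [pCommute_iff, Equiv.apply_symm_apply, Equiv.apply_symm_apply, sympForm_rootVec hv,
        inter_card_eq_zero_iff p q hne]
      exact hpq
    · simpa only [Equiv.apply_symm_apply] using rootVec_add_add hs hpq hpr hqr

/-- Any `N`-qubit doily root `(O, c)` — an ovoid `O = {o₁,…,o₅}` of five mutually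
anticommuting nonidentity observables whose product is `±` the identity, together with an
observable `c` commuting with `o₁, o₂, o₃` and anticommuting with `o₄, o₅` — determines
exactly one `N`-qubit doily containing `o₁, …, o₅` and `c` among its points. -/
theorem doily_root_determines_unique_doily (N : ℕ) (hN : 2 ≤ N)
    (o₁ o₂ o₃ o₄ o₅ c : Fin N → Fin 4)
    (hne : [o₁, o₂, o₃, o₄, o₅].Pairwise (· ≠ ·))
    (hid : ∀ o ∈ [o₁, o₂, o₃, o₄, o₅, c], o ≠ fun _ => 0)
    (hac : [o₁, o₂, o₃, o₄, o₅].Pairwise PAnticommute)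
    (hprod : obsMat o₁ * obsMat o₂ * obsMat o₃ * obsMat o₄ * obsMat o₅ = 1 ∨
             obsMat o₁ * obsMat o₂ * obsMat o₃ * obsMat o₄ * obsMat o₅ = -1)
    (hc₁ : PCommute c o₁) (hc₂ : PCommute c o₂) (hc₃ : PCommute c o₃)
    (hc₄ : PAnticommute c o₄) (hc₅ : PAnticommute c o₅) :
    ∃! D : Finset (Fin N → Fin 4),
      IsDoilySet N D ∧ o₁ ∈ D ∧ o₂ ∈ D ∧ o₃ ∈ D ∧ o₄ ∈ D ∧ o₅ ∈ D ∧ c ∈ D := by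
  simp only [List.pairwise_cons, List.mem_cons, List.not_mem_nil, or_false, forall_eq_or_imp,
    forall_eq, pAnticommute_iff, List.Pairwise.nil, and_true, false_imp_iff, implies_true] at hac
  obtain ⟨⟨h₁₂, h₁₃, h₁₄, h₁₅⟩, ⟨h₂₃, h₂₄, h₂₅⟩, ⟨h₃₄, h₃₅⟩, h₄₅⟩ := hac
  rw [pCommute_iff] at hc₁ hc₂ hc₃
  rw [pAnticommute_iff] at hc₄ hc₅
  have hsum := sum_wordBits_eq_zero (l := [o₁, o₂, o₃, o₄, o₅]) (by
    simpa [mul_assoc] using hprod)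
  simp only [List.map_cons, List.map_nil, List.sum_cons, List.sum_nil, add_zero] at hsum
  generalize hx₁ : wordBits N o₁ = x₁ at *
  generalize hx₂ : wordBits N o₂ = x₂ at *
  generalize hx₃ : wordBits N o₃ = x₃ at *
  generalize hx₄ : wordBits N o₄ = x₄ at *
  generalize hx₅ : wordBits N o₅ = x₅ at *
  generalize hy : wordBits N c = y at *
  have two : (1 : ZMod 2) + 1 = 0 := rfl
  let v : Fin 6 → Fin N → ZMod 2 × ZMod 2 := ![y + (x₄ + x₅), x₁, x₂, x₃, x₄, x₅]
  have hv : ∀ i j, sympForm N (v i) (v j) = rootGram i j := by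
    intro i j
    wlog hij : i ≤ j generalizing i j
    · have hg : rootGram i j = rootGram j i := by revert i j; decide
      rw [sympForm_comm, this j i (le_of_not_ge hij), hg]
    obtain rfl | hlt := hij.eq_or_lt
    · rw [sympForm_self, rootGram, if_pos (by tauto)]
    · fin_cases i <;> fin_cases j <;> first
        | exact absurd hlt (by decide)
        | simp [v, rootGram, sympForm_self, sympForm_comm x₅ x₁, sympForm_comm x₅ x₂,
            sympForm_comm x₅ x₃, sympForm_comm x₅ x₄, sympForm_comm x₄ x₁,
            sympForm_comm x₄ x₂, sympForm_comm x₄ x₃, h₁₂, h₁₃, h₁₄, h₁₅, h₂₃, h₂₄, h₂₅,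
            h₃₄, h₃₅, h₄₅, hc₁, hc₂, hc₃, hc₄, hc₅, two]
  have hs : ∑ i, v i = v 0 := by
    simp [v, Fin.sum_univ_succ, hsum]
  have hvc : v 0 + (v 4 + v 5) = y := by
    change y + (x₄ + x₅) + (x₄ + x₅) = y
    rw [add_assoc, ZModModule.add_self, add_zero]
  have hD : IsDoilySet N (Finset.univ.image fun p => (wordBits N).symm (rootVec v p)) :=
    ⟨_, isNQubitDoily_rootVec hv hs, rfl⟩
  have hmem : ∀ i ≠ 0, ∀ o : Fin N → Fin 4, wordBits N o = v i →
      o ∈ Finset.univ.image fun p => (wordBits N).symm (rootVec v p) := by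
    intro i hi o ho
    refine Finset.mem_image.2 ⟨⟨{0, i}, Finset.card_pair hi.symm⟩, Finset.mem_univ _, ?_⟩
    simp only [rootVec]
    rw [Finset.sum_pair hi.symm, ← add_assoc, ZModModule.add_self, zero_add, ← ho,
      Equiv.symm_apply_apply]
  refine ⟨_, ⟨hD, ?_⟩, ?_⟩
  · refine ⟨hmem 1 (by decide) _ hx₁, hmem 2 (by decide) _ hx₂,
      hmem 3 (by decide) _ hx₃, hmem 4 (by decide) _ hx₄,
      hmem 5 (by decide) _ hx₅, ?_⟩
    refine Finset.mem_image.2 ⟨⟨{4, 5}, rfl⟩, Finset.mem_univ _, ?_⟩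
    simp only [rootVec]
    rw [Finset.sum_pair (by decide), hvc, ← hy, Equiv.symm_apply_apply]
  · rintro D ⟨hD', h₁, h₂, h₃, h₄, h₅, hc⟩
    refine (Finset.eq_of_subset_of_card_le (image_rootVec_subset hv hs hD' ?_ ?_) ?_).symm
    · intro i hi
      fin_cases i
      · exact absurd rfl hi
      all_goals simpa [v, ← hx₁, ← hx₂, ← hx₃, ← hx₄, ← hx₅]
    · rwa [hvc, ← hy, Equiv.symm_apply_apply]
    · rw [hD.card_eq, hD'.card_eq]
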